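/- Let d ≥ 2 and κ ≥ 1 be coprime integers, let s ≥ 1 and t ≥ 0 be integers, set e = s + t, and let a_1 > a_2 > … > a_s ≥ 0 and b_1 > b_2 > … > b_t ≥ 0 be integers such that, setting ζ = e^{2πi/d}, the multiset {ζ^{a_1}, …, ζ^{a_s}, −ζ^{b_1}, …, −ζ^{b_t}} equals the multiset {w·η : η^e = 1} for some complex number w. For 1 ≤ m ≤ s put P_m = q^{a_m} · ∏_{1≤j≤s, j≠m}(q^{a_m} − q^{a_j}) · ∏_{1≤j≤t}(q^{a_m} + q^{b_j}), and for 1 ≤ m ≤ t put R_m = q^{b_m} · ∏_{1≤j≤s}(q^{b_m} + q^{a_j}) · ∏_{1≤j≤t, j≠m}(q^{b_m} − q^{b_j}). Then π_{κ/d}(P_i) > π_{κ/d}(P_{i+1}) for all 1 ≤ i ≤ s−1, and π_{κ/d}(R_i) > π_{κ/d}(R_{i+1}) for all 1 ≤ i ≤ t−1. -/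

import Mathlib

open Polynomial

/-- `argCount t f` is the cardinality of the multiset `Arg_t(f)` of real numbers `λ` with
`0 < λ ≤ 2πt` such that `e^{iλ}` is a (complex) root of the real polynomial `f`, each such `λ`
counted with the multiplicity of `e^{iλ}` as a root of `f`. -/
noncomputable def argCount (t : ℝ) (f : Polynomial ℝ) : ℕ :=
  ((f.map (algebraMap ℝ ℂ)).roots.map fun ξ =>
    Nat.card {l : ℝ // 0 < l ∧ l ≤ 2 * Real.pi * t ∧ Complex.exp ((l : ℂ) * Complex.I) = ξ}).sum

/-- `piFn κ d f` is the rational number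
`π_{κ/d}(f) = (a(f) + A(f))·(κ/d) + |Arg_{κ/d}(f)| + (1/2)·(multiplicity of 1 as a root of f)`,
where `a(f)` is the multiplicity of `0` as a root of `f` and `A(f)` is the degree of `f`. -/
noncomputable def piFn (κ d : ℕ) (f : Polynomial ℝ) : ℚ :=
  ((rootMultiplicity 0 f : ℚ) + (f.natDegree : ℚ)) * (κ : ℚ) / (d : ℚ)
    + (argCount ((κ : ℝ) / (d : ℝ)) f : ℚ) + (rootMultiplicity 1 f : ℚ) / 2

/-- The integers `n` strictly between `0` and `E` for which `y + n / e` is congruent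
to `γ` modulo `1`. -/
noncomputable def gridPoints (E : ℤ) (e : ℕ) (y γ : ℚ) : Finset ℤ := by
  classical exact {n ∈ Finset.Ioo 0 E | ∃ k : ℤ, (n : ℚ) = e * (γ - k - y)}

lemma floor_sub_floor_le_card_gridPoints {E : ℤ} {e : ℕ} (he : 0 < e) {x y g h : ℚ} (hyx : y < x)
    (hE : (E : ℚ) = e * (x - y)) (hh : 0 ≤ h) (hgrid : ∃ n : ℤ, e * (g + h - y) = n)
    (hy : (∀ n : ℤ, g + h - y ≠ n) ∨ (g = y ∧ h = 0)) :
    ⌊|y - g| + h⌋ - ⌊|x - g| + h⌋ ≤ ((gridPoints E e y (g + h)).card : ℤ) := by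
  classical
  have hpos : (0 : ℤ) ≤ ((gridPoints E e y (g + h)).card : ℤ) := by positivity
  have he' : (0 : ℚ) < e := by exact_mod_cast he
  rcases hy with hy | ⟨rfl, rfl⟩
  · rcases le_total g y with hgy | hgy
    · have : ⌊|y - g| + h⌋ ≤ ⌊|x - g| + h⌋ := by
        apply Int.floor_le_floor
        rw [abs_of_nonneg (by linarith), abs_of_nonneg (by linarith)]
        linarith
      linarith
    · have h1 : ⌊g + h - x⌋ ≤ ⌊|x - g| + h⌋ := by
        apply Int.floor_le_floor
        linarith [neg_abs_le (x - g)]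
      have h2 : |y - g| + h = g + h - y := by
        rw [abs_of_nonpos (by linarith)]; ring
      rw [h2]
      have h3 : (Finset.Ioc ⌊g + h - x⌋ ⌊g + h - y⌋).card ≤ (gridPoints E e y (g + h)).card := by
        obtain ⟨N, hN⟩ := hgrid
        apply Finset.card_le_card_of_injOn (fun n => N - e * n)
        · intro n hn
          simp only [Finset.coe_Ioc, Set.mem_Ioc] at hn
          have hn1 : g + h - x < n := Int.floor_lt.1 hn.1
          have hn2 : (n : ℚ) ≤ g + h - y := Int.le_floor.1 hn.2
          have hn3 : (n : ℚ) < g + h - y := lt_of_le_of_ne hn2 (hy n).symm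
          have key : ((N - e * n : ℤ) : ℚ) = e * (g + h - n - y) := by
            push_cast; rw [← hN]; ring
          simp only [gridPoints, Finset.coe_filter, Finset.mem_Ioo, Set.mem_ofPred_eq]
          refine ⟨⟨?_, ?_⟩, n, key⟩
          · have : (0 : ℚ) < ((N - e * n : ℤ) : ℚ) := by
              rw [key]; exact mul_pos he' (by linarith)
            exact_mod_cast this
          · have : ((N - e * n : ℤ) : ℚ) < E := by
              rw [key, hE]; exact mul_lt_mul_of_pos_left (by linarith) he'
            exact_mod_cast this
        · intro m _ n _ hmn
          simpa [he.ne'] using hmn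
      rw [Int.card_Ioc] at h3
      have := Int.self_le_toNat (⌊g + h - y⌋ - ⌊g + h - x⌋)
      have h4 : ((⌊g + h - y⌋ - ⌊g + h - x⌋).toNat : ℤ) ≤ (gridPoints E e y (g + h)).card := by
        exact_mod_cast h3
      linarith
  · have : 0 ≤ ⌊|x - g| + 0⌋ := Int.floor_nonneg.2 (by positivity)
    simp only [sub_self, abs_zero, add_zero, Int.floor_zero] at this hpos ⊢
    linarith

/-- If the points `g j + h j` lie on a common grid of mesh `1 / e` and are pairwise incongruent
modulo `1`, then the total variation of the floors between two of them is controlled by the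
number of grid points in between. -/
lemma sum_floor_sub_floor_lt {ι : Type*} (S : Finset ι) (g h : ι → ℚ) {e : ℕ} (he : 0 < e)
    (hh : ∀ j ∈ S, 0 ≤ h j)
    (hgrid : ∀ j ∈ S, ∀ k ∈ S, ∃ n : ℤ, e * (g j + h j - (g k + h k)) = n)
    (hinj : ∀ j ∈ S, ∀ k ∈ S, (∃ n : ℤ, g j + h j - (g k + h k) = n) → j = k)
    {i i' : ι} (hi : i ∈ S) (hi' : i' ∈ S) (h0 : h i = 0) (h0' : h i' = 0) (hlt : g i' < g i) :
    ((∑ j ∈ S, (⌊|g i' - g j| + h j⌋ - ⌊|g i - g j| + h j⌋) : ℤ) : ℚ) < e * (g i - g i') := by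
  classical
  have he' : (0 : ℚ) < e := by exact_mod_cast he
  obtain ⟨E, hE⟩ := hgrid i hi i' hi'
  rw [h0, h0', add_zero, add_zero] at hE
  have hEpos : 0 < E := by
    have : (0 : ℚ) < E := by rw [← hE]; exact mul_pos he' (by linarith)
    exact_mod_cast this
  have hsum : ∑ j ∈ S, (⌊|g i' - g j| + h j⌋ - ⌊|g i - g j| + h j⌋) ≤
      ∑ j ∈ S, ((gridPoints E e (g i') (g j + h j)).card : ℤ) := by
    refine Finset.sum_le_sum fun j hj => ?_
    apply floor_sub_floor_le_card_gridPoints he hlt hE.symm (hh j hj)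
    · simpa [h0'] using hgrid j hj i' hi'
    · by_cases hji : j = i'
      · right; subst hji; exact ⟨rfl, h0'⟩
      · left; intro n hn
        exact hji (hinj j hj i' hi' ⟨n, by rw [h0', add_zero, hn]⟩)
  have hcard : ∑ j ∈ S, (gridPoints E e (g i') (g j + h j)).card ≤ (Finset.Ioo 0 E).card := by
    rw [← Finset.card_biUnion]
    · apply Finset.card_le_card
      intro n hn
      obtain ⟨j, -, hj⟩ := Finset.mem_biUnion.1 hn
      exact (Finset.mem_filter.1 hj).1
    · intro j hj k hk hjk
      refine Finset.disjoint_left.2 fun n hn hn' => hjk (hinj j hj k hk ?_)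
      obtain ⟨p, hp⟩ := (Finset.mem_filter.1 hn).2
      obtain ⟨p', hp'⟩ := (Finset.mem_filter.1 hn').2
      refine ⟨p - p', ?_⟩
      have := mul_left_cancel₀ he'.ne' (hp.symm.trans hp')
      push_cast; linarith
  rw [Int.card_Ioo] at hcard
  have hcard' : ∑ j ∈ S, ((gridPoints E e (g i') (g j + h j)).card : ℤ) ≤ (E - 0 - 1).toNat := by
    exact_mod_cast hcard
  rw [hE]
  have : ∑ j ∈ S, (⌊|g i' - g j| + h j⌋ - ⌊|g i - g j| + h j⌋) < E := by omega
  exact_mod_cast this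

lemma argCount_mul (t : ℝ) {f g : ℝ[X]} (hf : f ≠ 0) (hg : g ≠ 0) :
    argCount t (f * g) = argCount t f + argCount t g := by
  have h : (f * g).map (algebraMap ℝ ℂ) ≠ 0 :=
    (Polynomial.map_ne_zero_iff (algebraMap ℝ ℂ).injective).2 (mul_ne_zero hf hg)
  rw [Polynomial.map_mul] at h
  simp [argCount, Polynomial.map_mul, Polynomial.roots_mul h]

lemma piFn_mul (κ d : ℕ) {f g : ℝ[X]} (hf : f ≠ 0) (hg : g ≠ 0) :
    piFn κ d (f * g) = piFn κ d f + piFn κ d g := by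
  have h := mul_ne_zero hf hg
  simp only [piFn, argCount_mul _ hf hg, Polynomial.rootMultiplicity_mul h,
    Polynomial.natDegree_mul hf hg]
  push_cast
  ring

lemma piFn_C (κ d : ℕ) (c : ℝ) : piFn κ d (C c) = 0 := by
  simp [piFn, argCount, Polynomial.rootMultiplicity_C]

lemma piFn_neg (κ d : ℕ) {f : ℝ[X]} (hf : f ≠ 0) : piFn κ d (-f) = piFn κ d f := by
  have h : -f = C (-1) * f := by simp
  rw [h, piFn_mul κ d (by simp) hf, piFn_C, zero_add]

lemma piFn_prod (κ d : ℕ) {ι : Type*} (S : Finset ι) (f : ι → ℝ[X]) (hf : ∀ i ∈ S, f i ≠ 0) :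
    piFn κ d (∏ i ∈ S, f i) = ∑ i ∈ S, piFn κ d (f i) := by
  classical
  induction S using Finset.induction_on with
  | empty => simpa using piFn_C κ d 1
  | insert i S hi ih =>
    have hS : ∀ j ∈ S, f j ≠ 0 := fun j hj => hf j (Finset.mem_insert_of_mem hj)
    rw [Finset.prod_insert hi, Finset.sum_insert hi,
      piFn_mul κ d (hf i (Finset.mem_insert_self i S)) (Finset.prod_ne_zero_iff.2 hS), ih hS]

lemma argCount_X_pow (t : ℝ) (n : ℕ) : argCount t (X ^ n) = 0 := by
  simp [argCount, Multiset.map_nsmul, Multiset.sum_nsmul]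

lemma piFn_X_pow (κ d n : ℕ) : piFn κ d (X ^ n) = 2 * n * ((κ : ℚ) / d) := by
  have h0 : rootMultiplicity 0 (X ^ n : ℝ[X]) = n := by
    simpa using Polynomial.rootMultiplicity_X_sub_C_pow (0 : ℝ) n
  have h1 : rootMultiplicity 1 (X ^ n : ℝ[X]) = 0 := by
    apply Polynomial.rootMultiplicity_eq_zero; simp
  rw [piFn, argCount_X_pow, h0, h1]
  simp
  ring

/-- When the roots of `f` are simple, `argCount t f` counts arguments of roots. -/
lemma argCount_eq_card (t : ℝ) (f : ℝ[X]) (S : Finset ℝ)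
    (hnd : (f.map (algebraMap ℝ ℂ)).roots.Nodup)
    (hS : ∀ l : ℝ, l ∈ S ↔ 0 < l ∧ l ≤ 2 * Real.pi * t ∧
      Complex.exp (l * Complex.I) ∈ (f.map (algebraMap ℝ ℂ)).roots) :
    argCount t f = S.card := by
  classical
  have hmaps : ∀ l ∈ S, Complex.exp (l * Complex.I) ∈ (f.map (algebraMap ℝ ℂ)).roots.toFinset :=
    fun l hl => Multiset.mem_toFinset.2 ((hS l).1 hl).2.2
  rw [Finset.card_eq_sum_card_fiberwise hmaps, Finset.sum, Multiset.toFinset_val, hnd.dedup,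
    argCount]
  congr 1
  refine Multiset.map_congr rfl fun ξ hξ => ?_
  rw [← Nat.card_eq_finsetCard]
  refine Nat.card_congr (Equiv.subtypeEquivRight fun l => ?_)
  rw [Finset.mem_filter, hS]
  exact ⟨fun ⟨h1, h2, h3⟩ => ⟨⟨h1, h2, h3 ▸ hξ⟩, h3⟩, fun ⟨⟨h1, h2, _⟩, h3⟩ => ⟨h1, h2, h3⟩⟩

lemma nodup_roots_map_X_pow_sub_C {n : ℕ} (hn : 0 < n) {c : ℝ} (hc : c ≠ 0) :
    ((X ^ n - C c : ℝ[X]).map (algebraMap ℝ ℂ)).roots.Nodup :=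
  Polynomial.nodup_roots
    ((Polynomial.separable_X_pow_sub_C c (by exact_mod_cast hn.ne') hc).map)

lemma argCount_X_pow_sub_C (t : ℝ) {n : ℕ} (hn : 0 < n) {c h : ℝ} (hh : 0 < h)
    (hh1 : h ≤ 1) (hc : Complex.exp (2 * Real.pi * h * Complex.I) = c) :
    argCount t (X ^ n - C c) = ⌊n * t + 1 - h⌋₊ := by
  have hn' : (0 : ℝ) < n := by exact_mod_cast hn
  have hpi := Real.pi_pos
  have hc0 : c ≠ 0 := by
    rintro rfl
    simp at hc
  have hne : (X ^ n - C c : ℝ[X]).map (algebraMap ℝ ℂ) ≠ 0 :=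
    (Polynomial.map_ne_zero_iff (algebraMap ℝ ℂ).injective).2 (Polynomial.X_pow_sub_C_ne_zero hn c)
  have hinj : Function.Injective (fun k : ℕ => 2 * Real.pi * ((k : ℝ) + h) / n) := by
    intro k k' hk
    have : 2 * Real.pi * ((k : ℝ) + h) = 2 * Real.pi * ((k' : ℝ) + h) := by
      simpa [div_left_inj' hn'.ne'] using hk
    have := mul_left_cancel₀ (by positivity) this
    exact_mod_cast add_right_cancel this
  rw [argCount_eq_card t _ ((Finset.range ⌊n * t + 1 - h⌋₊).map ⟨_, hinj⟩)
    (nodup_roots_map_X_pow_sub_C hn hc0), Finset.card_map, Finset.card_range]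
  intro l
  have hroot : Complex.exp (l * Complex.I) ∈
      ((X ^ n - C c : ℝ[X]).map (algebraMap ℝ ℂ)).roots ↔
      ∃ k : ℤ, n * l = 2 * Real.pi * (k + h) := by
    rw [Polynomial.mem_roots hne, Polynomial.IsRoot.def]
    simp only [Polynomial.map_sub, Polynomial.map_pow, Polynomial.map_X, Polynomial.map_C,
      Polynomial.eval_sub, Polynomial.eval_pow, Polynomial.eval_X, Polynomial.eval_C,
      Complex.coe_algebraMap, sub_eq_zero]
    rw [← hc, ← Complex.exp_nat_mul, Complex.exp_eq_exp_iff_exists_int]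
    refine exists_congr fun k => ?_
    have h1 : (n : ℂ) * (l * Complex.I) = ((n * l : ℝ) : ℂ) * Complex.I := by push_cast; ring
    have h2 : 2 * (Real.pi : ℂ) * h * Complex.I + k * (2 * Real.pi * Complex.I) =
        ((2 * Real.pi * (k + h) : ℝ) : ℂ) * Complex.I := by push_cast; ring
    rw [h1, h2, mul_left_inj' Complex.I_ne_zero, Complex.ofReal_inj]
  rw [hroot]
  simp only [Finset.mem_map, Finset.mem_range, Function.Embedding.coeFn_mk]
  have hfloor : ∀ k : ℕ, k < ⌊n * t + 1 - h⌋₊ ↔ (k : ℝ) + h ≤ n * t := by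
    intro k
    rw [← Nat.succ_le_iff, Nat.le_floor_iff' (Nat.succ_ne_zero k)]
    push_cast
    constructor <;> intro <;> linarith
  constructor
  · rintro ⟨k, hk, rfl⟩
    rw [hfloor] at hk
    refine ⟨by positivity, ?_, k, ?_⟩
    · rw [div_le_iff₀ hn']
      nlinarith
    · push_cast; field_simp
  · rintro ⟨hl, hlt, k, hk⟩
    have hk0 : 0 < (k : ℝ) + h := by
      have : 0 < 2 * Real.pi * ((k : ℝ) + h) := by rw [← hk]; positivity
      exact pos_of_mul_pos_right this (by positivity)
    have hk1 : 0 ≤ k := by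
      have : (-1 : ℝ) < k := by linarith
      have : -1 < k := by exact_mod_cast this
      omega
    lift k to ℕ using hk1
    refine ⟨k, ?_, ?_⟩
    · rw [hfloor]
      have h3 : 2 * Real.pi * ((k : ℝ) + h) ≤ 2 * Real.pi * (n * t) := by
        have := mul_le_mul_of_nonneg_left hlt hn'.le
        push_cast at hk
        linarith
      exact le_of_mul_le_mul_left h3 (by positivity)
    · push_cast at hk
      rw [← hk]; field_simp

lemma natFloor_rat_real (q : ℚ) (hq : 0 ≤ q) {x : ℝ} (hx : x = q) :
    ((⌊x⌋₊ : ℕ) : ℚ) = ((⌊q⌋ : ℤ) : ℚ) := by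
  have h : ((⌊x⌋₊ : ℕ) : ℤ) = ⌊q⌋ := by
    rw [Int.natCast_floor_eq_floor (by rw [hx]; exact_mod_cast hq), hx, Rat.floor_cast]
  exact_mod_cast h

lemma rootMultiplicity_zero_X_pow_sub_C {n : ℕ} (hn : 0 < n) {c : ℝ} (hc : c ≠ 0) :
    rootMultiplicity 0 (X ^ n - C c : ℝ[X]) = 0 := by
  apply Polynomial.rootMultiplicity_eq_zero
  simp [hn.ne', hc]

lemma piFn_X_pow_sub_one (κ d : ℕ) {n : ℕ} (hn : 0 < n) :
    piFn κ d (X ^ n - 1) = n * ((κ : ℚ) / d) + ⌊(n : ℚ) * (κ / d)⌋ + 1 / 2 := by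
  have hC : (X ^ n - 1 : ℝ[X]) = X ^ n - C 1 := by simp
  have h1 : rootMultiplicity 1 (X ^ n - C 1 : ℝ[X]) = 1 := by
    have hnd : (X ^ n - C 1 : ℝ[X]).roots.Nodup :=
      Polynomial.nodup_roots
        (Polynomial.separable_X_pow_sub_C 1 (by exact_mod_cast hn.ne') one_ne_zero)
    rw [← Polynomial.count_roots]
    apply Multiset.count_eq_one_of_mem hnd
    rw [Polynomial.mem_roots (Polynomial.X_pow_sub_C_ne_zero hn 1)]
    simp
  have hexp : Complex.exp (2 * Real.pi * (1 : ℝ) * Complex.I) = (1 : ℝ) := by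
    simp
  rw [hC, piFn, rootMultiplicity_zero_X_pow_sub_C hn one_ne_zero, h1,
    Polynomial.natDegree_X_pow_sub_C, argCount_X_pow_sub_C _ hn one_pos le_rfl hexp,
    natFloor_rat_real ((n : ℚ) * (κ / d)) (by positivity) (by push_cast; ring)]
  push_cast
  ring

lemma piFn_X_pow_add_one (κ d n : ℕ) :
    piFn κ d (X ^ n + 1) = n * ((κ : ℚ) / d) + ⌊(n : ℚ) * (κ / d) + 1 / 2⌋ := by
  rcases Nat.eq_zero_or_pos n with rfl | hn
  · have h2 : (X ^ 0 + 1 : ℝ[X]) = C 2 := by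
      rw [pow_zero, one_add_one_eq_two]; rfl
    rw [h2, piFn_C]
    norm_num
  have hC : (X ^ n + 1 : ℝ[X]) = X ^ n - C (-1) := by simp
  have hexp : Complex.exp (2 * Real.pi * (1 / 2 : ℝ) * Complex.I) = ((-1 : ℝ) : ℂ) := by
    have : 2 * (Real.pi : ℂ) * (1 / 2 : ℝ) * Complex.I = Real.pi * Complex.I := by
      push_cast; ring
    rw [this, Complex.exp_pi_mul_I]; simp
  have h1 : rootMultiplicity 1 (X ^ n - C (-1) : ℝ[X]) = 0 := by
    apply Polynomial.rootMultiplicity_eq_zero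
    simp only [IsRoot.def, eval_sub, eval_pow, eval_X, eval_C]
    norm_num
  rw [hC, piFn, rootMultiplicity_zero_X_pow_sub_C hn (by norm_num), h1,
    Polynomial.natDegree_X_pow_sub_C,
    argCount_X_pow_sub_C _ hn (by norm_num) (by norm_num) hexp,
    natFloor_rat_real ((n : ℚ) * (κ / d) + 1 / 2) (by positivity) (by push_cast; ring)]
  push_cast
  ring

lemma X_pow_sub_X_pow_ne_zero {a b : ℕ} (hab : a ≠ b) : (X ^ a - X ^ b : ℝ[X]) ≠ 0 := fun h =>
  hab (by simpa using congrArg Polynomial.natDegree (sub_eq_zero.1 h))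

lemma X_pow_add_X_pow_ne_zero (a b : ℕ) : (X ^ a + X ^ b : ℝ[X]) ≠ 0 := fun h => by
  have := congrArg (Polynomial.eval 1) h
  norm_num at this

lemma piFn_X_pow_sub_X_pow (κ d : ℕ) {a b : ℕ} (hab : a ≠ b) :
    piFn κ d (X ^ a - X ^ b) =
      (a + b) * ((κ : ℚ) / d) + ⌊|(a : ℚ) * (κ / d) - b * (κ / d)|⌋ + 1 / 2 := by
  wlog hlt : b < a generalizing a b
  · rw [← neg_sub, piFn_neg κ d (X_pow_sub_X_pow_ne_zero hab.symm),
      this hab.symm (by omega), abs_sub_comm]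
    ring
  obtain ⟨n, rfl⟩ := Nat.exists_eq_add_of_lt hlt
  have hf : (X ^ (b + n + 1) - X ^ b : ℝ[X]) = X ^ b * (X ^ (n + 1) - 1) := by ring
  have hne : (X ^ (n + 1) - 1 : ℝ[X]) ≠ 0 := by
    simpa using X_pow_sub_X_pow_ne_zero (Nat.succ_ne_zero n)
  have habs : |((b + n + 1 : ℕ) : ℚ) * (κ / d) - b * (κ / d)| = ((n + 1 : ℕ) : ℚ) * (κ / d) := by
    rw [← sub_mul, abs_of_nonneg]
    · push_cast; ring
    · push_cast
      exact mul_nonneg (by linarith [(Nat.cast_nonneg n : (0 : ℚ) ≤ n)]) (by positivity)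
  rw [hf, piFn_mul κ d (by simp) hne, piFn_X_pow, piFn_X_pow_sub_one κ d (Nat.succ_pos n), habs]
  push_cast
  ring

lemma piFn_X_pow_add_X_pow (κ d a b : ℕ) :
    piFn κ d (X ^ a + X ^ b) =
      (a + b) * ((κ : ℚ) / d) + ⌊|(a : ℚ) * (κ / d) - b * (κ / d)| + 1 / 2⌋ := by
  wlog hle : b ≤ a generalizing a b
  · rw [add_comm, this b a (by omega), abs_sub_comm]
    ring
  obtain ⟨n, rfl⟩ := Nat.exists_eq_add_of_le hle
  have hf : (X ^ (b + n) + X ^ b : ℝ[X]) = X ^ b * (X ^ n + 1) := by ring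
  have hne : (X ^ n + 1 : ℝ[X]) ≠ 0 := by simpa using X_pow_add_X_pow_ne_zero n 0
  have habs : |((b + n : ℕ) : ℚ) * (κ / d) - b * (κ / d)| = (n : ℚ) * (κ / d) := by
    rw [← sub_mul, abs_of_nonneg]
    · push_cast; ring
    · push_cast
      exact mul_nonneg (by linarith [(Nat.cast_nonneg n : (0 : ℚ) ≤ n)]) (by positivity)
  rw [hf, piFn_mul κ d (by simp) hne, piFn_X_pow, piFn_X_pow_add_one, habs]
  push_cast
  ring

/-- The value of `piFn` at the Hecke polynomial of the parameter `X ^ a m`: a linear term in `a m`,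
a term independent of `m`, and a sum of floors of distances to the other parameters. -/
lemma piFn_X_pow_mul_prod (κ d s t : ℕ) (a b : ℕ → ℕ)
    (ha : Set.InjOn a (Finset.Icc 1 s)) {m : ℕ} (hm : m ∈ Finset.Icc 1 s) :
    piFn κ d (X ^ a m * (∏ j ∈ (Finset.Icc 1 s).erase m, (X ^ a m - X ^ a j)) *
        ∏ j ∈ Finset.Icc 1 t, (X ^ a m + X ^ b j)) =
      (s + t) * (a m * ((κ : ℚ) / d)) +
      ((∑ j ∈ Finset.Icc 1 s, (a j * ((κ : ℚ) / d) + 1 / 2)) +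
        (∑ j ∈ Finset.Icc 1 t, b j * ((κ : ℚ) / d)) - 1 / 2) +
      ((∑ j ∈ Finset.Icc 1 s, (⌊|(a m : ℚ) * (κ / d) - a j * (κ / d)|⌋ : ℚ)) +
        ∑ j ∈ Finset.Icc 1 t, (⌊|(a m : ℚ) * (κ / d) - b j * (κ / d)| + 1 / 2⌋ : ℚ)) := by
  have hne : ∀ j ∈ (Finset.Icc 1 s).erase m, (X ^ a m - X ^ a j : ℝ[X]) ≠ 0 := fun j hj =>
    X_pow_sub_X_pow_ne_zero fun h =>
      (Finset.mem_erase.1 hj).1 (ha (Finset.mem_erase.1 hj).2 hm h.symm)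
  have hne' : ∀ j ∈ Finset.Icc 1 t, (X ^ a m + X ^ b j : ℝ[X]) ≠ 0 := fun j _ =>
    X_pow_add_X_pow_ne_zero _ _
  have hX : (X ^ a m : ℝ[X]) ≠ 0 := by simp
  rw [piFn_mul κ d (mul_ne_zero hX (Finset.prod_ne_zero_iff.2 hne))
      (Finset.prod_ne_zero_iff.2 hne'),
    piFn_mul κ d hX (Finset.prod_ne_zero_iff.2 hne), piFn_prod κ d _ _ hne,
    piFn_prod κ d _ _ hne', piFn_X_pow]
  have h1 : ∑ j ∈ (Finset.Icc 1 s).erase m, piFn κ d (X ^ a m - X ^ a j) =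
      ∑ j ∈ (Finset.Icc 1 s).erase m, ((a m + a j) * ((κ : ℚ) / d) +
        ⌊|(a m : ℚ) * (κ / d) - a j * (κ / d)|⌋ + 1 / 2) :=
    Finset.sum_congr rfl fun j hj => piFn_X_pow_sub_X_pow κ d fun h =>
      (Finset.mem_erase.1 hj).1 (ha (Finset.mem_erase.1 hj).2 hm h.symm)
  rw [h1, Finset.sum_erase_eq_sub hm]
  simp only [piFn_X_pow_add_X_pow, Finset.sum_add_distrib, add_mul, Finset.sum_const, Nat.card_Icc,
    sub_self, abs_zero, Int.floor_zero, nsmul_eq_mul, Nat.add_sub_cancel, Int.cast_zero]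
  ring

/-- An integer coprime to `d` has an odd lift modulo `d` that is coprime to `2 * d`. -/
lemma exists_odd_coprime_modEq {κ d : ℕ} (hcop : Nat.Coprime κ d) :
    ∃ K m : ℤ, Odd K ∧ K = κ + d * m ∧ IsCoprime (2 * d : ℤ) K := by
  have hc : IsCoprime (κ : ℤ) d := Nat.isCoprime_iff_coprime.2 hcop
  have key : ∀ m : ℤ, Odd ((κ : ℤ) + d * m) →
      ∃ K m : ℤ, Odd K ∧ K = κ + d * m ∧ IsCoprime (2 * d : ℤ) K := fun m hodd =>
    ⟨_, m, hodd, rfl, IsCoprime.mul_left (Int.isCoprime_two_left.2 hodd)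
      (hc.symm.add_mul_left_right m)⟩
  rcases Nat.even_or_odd κ with hκ | hκ
  · apply key 1
    have hd : Odd d := by
      rw [← Nat.not_even_iff_odd]
      intro hd
      have := Nat.dvd_gcd hκ.two_dvd hd.two_dvd
      rw [hcop] at this
      omega
    have h1 : Even (κ : ℤ) := by exact_mod_cast hκ
    have h2 : Odd (d : ℤ) := by exact_mod_cast hd
    simpa using h1.add_odd h2
  · apply key 0
    simpa using hκ

/-- The exponents of the parameters, written as powers of a primitive `2 * d`-th root of unity. -/
def paramExp (d : ℕ) (a b : ℕ → ℕ) : ℕ ⊕ ℕ → ℕ :=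
  Sum.elim (fun j => 2 * a j) (fun j => 2 * b j + d)

lemma paramExp_congr {κ d : ℕ} (hd : 0 < d) {K m : ℤ} (hodd : Odd K) (hK : K = κ + d * m)
    (a b : ℕ → ℕ) (j : ℕ ⊕ ℕ) : ∃ n : ℤ,
      Sum.elim (fun j => (a j : ℚ) * (κ / d)) (fun j => (b j : ℚ) * (κ / d)) j +
        Sum.elim (fun _ => 0) (fun _ => 1 / 2) j = K * paramExp d a b j / (2 * d) + n := by
  have hd' : (d : ℚ) ≠ 0 := by exact_mod_cast hd.ne'
  obtain ⟨p, hp⟩ := hodd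
  have hK' : (K : ℚ) = κ + d * m := by exact_mod_cast hK
  have hp' : (K : ℚ) = 2 * p + 1 := by exact_mod_cast hp
  rcases j with j | j
  · refine ⟨-(a j * m), ?_⟩
    simp only [Sum.elim_inl, paramExp, hK']
    push_cast
    field_simp
    ring
  · refine ⟨-(b j * m + p), ?_⟩
    simp only [Sum.elim_inr, paramExp]
    have : (K : ℚ) * ((2 * b j + d : ℕ) : ℚ) = 2 * b j * (κ + d * m) + d * (2 * p + 1) := by
      push_cast
      rw [← hK', ← hp']; ring
    rw [this]
    push_cast
    field_simp
    ring

lemma piFn_lt_of_paramExp {κ d : ℕ} (hd : 0 < d) (hκ : 0 < κ) (hcop : Nat.Coprime κ d)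
    {s t : ℕ} (a b : ℕ → ℕ)
    (hgrid : ∀ j ∈ (Finset.Icc 1 s).disjSum (Finset.Icc 1 t),
      ∀ k ∈ (Finset.Icc 1 s).disjSum (Finset.Icc 1 t),
      (2 * d : ℤ) ∣ (s + t : ℕ) * (paramExp d a b j - paramExp d a b k))
    (hinj : ∀ j ∈ (Finset.Icc 1 s).disjSum (Finset.Icc 1 t),
      ∀ k ∈ (Finset.Icc 1 s).disjSum (Finset.Icc 1 t),
      (2 * d : ℤ) ∣ paramExp d a b j - paramExp d a b k → j = k)
    {i i' : ℕ} (hi : i ∈ Finset.Icc 1 s) (hi' : i' ∈ Finset.Icc 1 s) (hlt : a i' < a i) :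
    piFn κ d (X ^ a i' * (∏ j ∈ (Finset.Icc 1 s).erase i', (X ^ a i' - X ^ a j)) *
        ∏ j ∈ Finset.Icc 1 t, (X ^ a i' + X ^ b j)) <
    piFn κ d (X ^ a i * (∏ j ∈ (Finset.Icc 1 s).erase i, (X ^ a i - X ^ a j)) *
        ∏ j ∈ Finset.Icc 1 t, (X ^ a i + X ^ b j)) := by
  have hd' : (0 : ℚ) < d := by exact_mod_cast hd
  have hr : (0 : ℚ) < κ / d := div_pos (by exact_mod_cast hκ) hd'
  have ha : Set.InjOn a (Finset.Icc 1 s) := fun j hj k hk hjk =>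
    Sum.inl_injective (hinj (Sum.inl j) (Finset.inl_mem_disjSum.2 hj) (Sum.inl k)
      (Finset.inl_mem_disjSum.2 hk) (by simp [paramExp, hjk]))
  rw [piFn_X_pow_mul_prod κ d s t a b ha hi, piFn_X_pow_mul_prod κ d s t a b ha hi']
  obtain ⟨K, m, hodd, hK, hKd⟩ := exists_odd_coprime_modEq hcop
  have hcong := paramExp_congr hd hodd hK a b
  have hst : 0 < s + t := by
    have := Finset.mem_Icc.1 hi
    omega
  have key := sum_floor_sub_floor_lt ((Finset.Icc 1 s).disjSum (Finset.Icc 1 t))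
    (Sum.elim (fun j => (a j : ℚ) * (κ / d)) (fun j => (b j : ℚ) * (κ / d)))
    (Sum.elim (fun _ => 0) (fun _ => 1 / 2)) hst ?_ ?_ ?_
    (Finset.inl_mem_disjSum.2 hi) (Finset.inl_mem_disjSum.2 hi') rfl rfl ?_
  · rw [Finset.sum_disjSum] at key
    simp only [Sum.elim_inl, Sum.elim_inr, add_zero] at key
    push_cast [Finset.sum_sub_distrib] at key
    linarith
  · rintro (j | j) _ <;> simp
  · intro j hj k hk
    obtain ⟨p, hp⟩ := hcong j
    obtain ⟨q, hq⟩ := hcong k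
    obtain ⟨N, hN⟩ := hgrid j hj k hk
    have hN' : ((s + t : ℕ) : ℚ) * (paramExp d a b j - paramExp d a b k) = 2 * d * N := by
      exact_mod_cast hN
    refine ⟨K * N + (s + t : ℕ) * (p - q), ?_⟩
    rw [hp, hq]
    have h2 : ((s + t : ℕ) : ℚ) * (K * paramExp d a b j / (2 * d) + p -
        (K * paramExp d a b k / (2 * d) + q)) =
        K * (((s + t : ℕ) : ℚ) * (paramExp d a b j - paramExp d a b k)) / (2 * d) +
          (s + t : ℕ) * (p - q) := by ring
    rw [h2, hN']
    push_cast
    field_simp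
  · rintro j hj k hk ⟨n, hn⟩
    obtain ⟨p, hp⟩ := hcong j
    obtain ⟨q, hq⟩ := hcong k
    apply hinj j hj k hk
    apply hKd.dvd_of_dvd_mul_left
    refine ⟨n - p + q, ?_⟩
    rw [hp, hq] at hn
    field_simp at hn
    have : (K : ℚ) * (paramExp d a b j - paramExp d a b k) = 2 * d * (n - p + q) := by
      linarith
    exact_mod_cast this
  · simp only [Sum.elim_inl]
    exact mul_lt_mul_of_pos_right (by exact_mod_cast hlt) hr

lemma exp_pow_eq_iff_dvd {d : ℕ} (hd : 0 < d) (p q : ℕ) :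
    Complex.exp (2 * Real.pi * Complex.I / ((2 * d : ℕ) : ℂ)) ^ p =
      Complex.exp (2 * Real.pi * Complex.I / ((2 * d : ℕ) : ℂ)) ^ q ↔
    (2 * d : ℤ) ∣ (p : ℤ) - q := by
  have hω := Complex.isPrimitiveRoot_exp (2 * d) (by omega)
  have h0 := Complex.exp_ne_zero (2 * Real.pi * Complex.I / ((2 * d : ℕ) : ℂ))
  have h := hω.zpow_eq_one_iff_dvd (p - q)
  rw [zpow_sub₀ h0, zpow_natCast, zpow_natCast, div_eq_one_iff_eq (pow_ne_zero _ h0)] at h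
  exact_mod_cast h

lemma param_eq_exp_pow {d : ℕ} (hd : 0 < d) (a b : ℕ → ℕ) (j : ℕ ⊕ ℕ) :
    Sum.elim (fun m => Complex.exp (2 * Real.pi * Complex.I / d) ^ a m)
      (fun m => -Complex.exp (2 * Real.pi * Complex.I / d) ^ b m) j =
    Complex.exp (2 * Real.pi * Complex.I / ((2 * d : ℕ) : ℂ)) ^ paramExp d a b j := by
  have hd' : (d : ℂ) ≠ 0 := by exact_mod_cast hd.ne'
  have h2 : Complex.exp (2 * Real.pi * Complex.I / ((2 * d : ℕ) : ℂ)) ^ 2 =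
      Complex.exp (2 * Real.pi * Complex.I / d) := by
    rw [← Complex.exp_nat_mul]
    congr 1
    push_cast
    field_simp
  have h1 : Complex.exp (2 * Real.pi * Complex.I / ((2 * d : ℕ) : ℂ)) ^ d = -1 := by
    rw [← Complex.exp_nat_mul, ← Complex.exp_pi_mul_I]
    congr 1
    push_cast
    field_simp
  rcases j with j | j
  · simp only [paramExp, Sum.elim_inl, pow_mul, h2]
  · simp only [paramExp, Sum.elim_inr, pow_add, pow_mul, h2, h1, mul_neg_one]

lemma nodup_map_mul_exp {e : ℕ} (he : 0 < e) {w : ℂ} (hw : w ≠ 0) :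
    ((Multiset.range e).map fun k : ℕ =>
      w * Complex.exp (2 * (Real.pi : ℂ) * Complex.I * (k : ℂ) / (e : ℂ))).Nodup := by
  refine Multiset.Nodup.map_on ?_ (Multiset.nodup_range e)
  intro p hp q hq hpq
  have hζ := Complex.isPrimitiveRoot_exp e he.ne'
  refine hζ.pow_inj (Multiset.mem_range.1 hp) (Multiset.mem_range.1 hq) ?_
  have h := mul_left_cancel₀ hw hpq
  rw [← Complex.exp_nat_mul, ← Complex.exp_nat_mul]
  convert h using 2 <;> ring

/-- Parameters forming a coset of the `e`-th roots of unity have exponents that are pairwise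
incongruent modulo `2 * d` and congruent to each other modulo `2 * d / e`. -/
lemma paramExp_dvd_of_eq_coset {d s t e : ℕ} (hd : 0 < d) (hst : e = s + t) (a b : ℕ → ℕ) (w : ℂ)
    (hroots : ((Multiset.range s).map fun m =>
          Complex.exp (2 * (Real.pi : ℂ) * Complex.I / (d : ℂ)) ^ a (m + 1)) +
        ((Multiset.range t).map fun m =>
          -Complex.exp (2 * (Real.pi : ℂ) * Complex.I / (d : ℂ)) ^ b (m + 1)) =
      (Multiset.range e).map fun k : ℕ =>
        w * Complex.exp (2 * (Real.pi : ℂ) * Complex.I * (k : ℂ) / (e : ℂ))) :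
    ∀ j ∈ (Finset.Icc 1 s).disjSum (Finset.Icc 1 t),
      ∀ k ∈ (Finset.Icc 1 s).disjSum (Finset.Icc 1 t),
      (2 * d : ℤ) ∣ (s + t : ℕ) * (paramExp d a b j - paramExp d a b k) ∧
      ((2 * d : ℤ) ∣ paramExp d a b j - paramExp d a b k → j = k) := by
  set z : ℕ ⊕ ℕ → ℂ := Sum.elim (fun m => Complex.exp (2 * Real.pi * Complex.I / d) ^ a m)
      (fun m => -Complex.exp (2 * Real.pi * Complex.I / d) ^ b m) with hz
  have hz0 : ∀ j, z j ≠ 0 := by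
    rintro (j | j) <;> simp [hz]
  have hmap : (((Finset.Icc 1 s).disjSum (Finset.Icc 1 t)).val.map z) =
      (Multiset.range e).map fun k : ℕ =>
        w * Complex.exp (2 * (Real.pi : ℂ) * Complex.I * (k : ℂ) / (e : ℂ)) := by
    rw [← hroots]
    have hIcc : ∀ n : ℕ, (Finset.Icc 1 n).val = (Multiset.range n).map (· + 1) := by
      intro n
      have h : Finset.Icc 1 n = (Finset.range n).map (addRightEmbedding 1) := by
        ext k
        simp only [Finset.mem_Icc, Finset.mem_map, Finset.mem_range, addRightEmbedding_apply]
        exact ⟨fun h => ⟨k - 1, by omega, by omega⟩, by rintro ⟨l, hl, rfl⟩; omega⟩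
      rw [h]
      rfl
    rw [Finset.val_disjSum, Multiset.disjSum, Multiset.map_add, hIcc, hIcc]
    simp only [Multiset.map_map]
    rfl
  intro j hj k hk
  have hmem : ∀ l ∈ (Finset.Icc 1 s).disjSum (Finset.Icc 1 t), ∃ n < e,
      w * Complex.exp (2 * (Real.pi : ℂ) * Complex.I * (n : ℂ) / (e : ℂ)) = z l := by
    intro l hl
    have := Multiset.mem_map_of_mem z (Finset.mem_def.1 hl)
    rw [hmap] at this
    simpa using this
  have hw : w ≠ 0 := by
    rintro rfl
    obtain ⟨n, -, hn⟩ := hmem j hj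
    exact hz0 j (by rw [← hn, zero_mul])
  have he : 0 < e := by
    obtain ⟨n, hn, -⟩ := hmem j hj
    omega
  have hpow : ∀ l ∈ (Finset.Icc 1 s).disjSum (Finset.Icc 1 t), z l ^ e = w ^ e := by
    intro l hl
    obtain ⟨n, -, hn⟩ := hmem l hl
    have he' : (e : ℂ) ≠ 0 := by exact_mod_cast he.ne'
    rw [← hn, mul_pow, ← Complex.exp_nat_mul]
    have h : (e : ℂ) * (2 * Real.pi * Complex.I * n / e) = n * (2 * Real.pi * Complex.I) := by
      field_simp
    rw [h, Complex.exp_nat_mul_two_pi_mul_I, mul_one]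
  constructor
  · have h := (hpow j hj).trans (hpow k hk).symm
    rw [hz, param_eq_exp_pow hd, param_eq_exp_pow hd, ← pow_mul, ← pow_mul,
      exp_pow_eq_iff_dvd hd] at h
    rw [← hst]
    push_cast at h
    convert h using 1
    ring
  · intro h
    refine Multiset.inj_on_of_nodup_map (hmap ▸ nodup_map_mul_exp he hw) j hj k hk ?_
    rw [hz, param_eq_exp_pow hd, param_eq_exp_pow hd, exp_pow_eq_iff_dvd hd]
    exact h

/-- Proposition 7.4 (increasing perversity for cyclotomic Hecke algebras of type `(s,t)` and
ambiance `d`): given strictly decreasing nonnegative integers `a 1 > … > a s` and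
`b 1 > … > b t` such that, with `ζ = e^{2πi/d}`, the multiset
`{ζ^{a 1}, …, ζ^{a s}, −ζ^{b 1}, …, −ζ^{b t}}` is `{w·η : η^e = 1}` for some `w ∈ ℂ`
(`e = s + t`), the `π_{κ/d}`-values of the polynomials
`P m = q^{a m}·∏_{j≠m}(q^{a m} − q^{a j})·∏_j(q^{a m} + q^{b j})` and
`R m = q^{b m}·∏_j(q^{b m} + q^{a j})·∏_{j≠m}(q^{b m} − q^{b j})` are strictly decreasing
in `m`. -/
theorem piFn_hecke_decreasing (κ d : ℕ) (hd : 2 ≤ d) (hκ : 1 ≤ κ) (hcop : Nat.Coprime κ d)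
    (s t e : ℕ) (hs : 1 ≤ s) (hst : e = s + t)
    (a b : ℕ → ℕ)
    (ha : ∀ i, 1 ≤ i → i < s → a (i + 1) < a i)
    (hb : ∀ i, 1 ≤ i → i < t → b (i + 1) < b i)
    (hroots : ∃ w : ℂ,
      ((Multiset.range s).map fun m =>
          Complex.exp (2 * (Real.pi : ℂ) * Complex.I / (d : ℂ)) ^ a (m + 1)) +
        ((Multiset.range t).map fun m =>
          -Complex.exp (2 * (Real.pi : ℂ) * Complex.I / (d : ℂ)) ^ b (m + 1)) =
      (Multiset.range e).map fun k =>
        w * Complex.exp (2 * (Real.pi : ℂ) * Complex.I * (k : ℂ) / (e : ℂ)))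
    (P R : ℕ → Polynomial ℝ)
    (hP : ∀ m, P m = X ^ a m *
        (∏ j ∈ (Finset.Icc 1 s).erase m, (X ^ a m - X ^ a j)) *
        ∏ j ∈ Finset.Icc 1 t, (X ^ a m + X ^ b j))
    (hR : ∀ m, R m = X ^ b m *
        (∏ j ∈ Finset.Icc 1 s, (X ^ b m + X ^ a j)) *
        ∏ j ∈ (Finset.Icc 1 t).erase m, (X ^ b m - X ^ b j)) :
    (∀ i, 1 ≤ i → i < s → piFn κ d (P (i + 1)) < piFn κ d (P i)) ∧
    (∀ i, 1 ≤ i → i < t → piFn κ d (R (i + 1)) < piFn κ d (R i)) := by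
  obtain ⟨w, hw⟩ := hroots
  simp only [Multiset.bind_def, Multiset.pure_def, Multiset.bind_singleton, Multiset.map_map,
    Function.comp_def] at hw
  have hd0 : 0 < d := by omega
  have hA := paramExp_dvd_of_eq_coset hd0 hst a b w hw
  have hB := paramExp_dvd_of_eq_coset hd0 (hst.trans (add_comm s t)) b a (-w) (by
    have := congrArg (Multiset.map Neg.neg) hw
    rw [Multiset.map_add, add_comm] at this
    simpa only [Multiset.map_map, Function.comp_def, neg_neg, neg_mul] using this)
  constructor
  · intro i hi his
    rw [hP, hP]
    exact piFn_lt_of_paramExp hd0 hκ hcop a b (fun j hj k hk => (hA j hj k hk).1)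
      (fun j hj k hk => (hA j hj k hk).2) (Finset.mem_Icc.2 ⟨hi, his.le⟩)
      (Finset.mem_Icc.2 ⟨by omega, his⟩) (ha i hi his)
  · intro i hi hit
    rw [hR, hR, mul_right_comm, mul_right_comm (X ^ b i)]
    exact piFn_lt_of_paramExp hd0 hκ hcop b a (fun j hj k hk => (hB j hj k hk).1)
      (fun j hj k hk => (hB j hj k hk).2) (Finset.mem_Icc.2 ⟨hi, hit.le⟩)
      (Finset.mem_Icc.2 ⟨by omega, hit⟩) (hb i hi hit)
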